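/- Let α be a partition of an even number. If α is special (in the e-count sense), then its C-collapse α_C is special. -/

import Mathlib

namespace WFPaper

/-- The list of parts of a partition (multiset of positive integers) in weakly
decreasing order. -/
def sortedDesc (s : Multiset ℕ) : List ℕ := (s.sort (· ≤ ·)).reverse

/-- The `j`-th largest part of `s` (1-indexed); `0` if `j = 0` or `j > #s`. -/
def part (s : Multiset ℕ) (j : ℕ) : ℕ := (sortedDesc s).getD (j - 1) 0

/-- The smallest part of `s` (`0` if `s` is empty). -/
def minPart (s : Multiset ℕ) : ℕ := (s.sort (· ≤ ·)).getD 0 0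

/-- Sum of the `j` largest parts of `s`. -/
def psum (s : Multiset ℕ) (j : ℕ) : ℕ := ((sortedDesc s).take j).sum

/-- Dominance order: `DomLE a b` means `a ≤ b` in the dominance order, i.e.
for every `j` the sum of the `j` largest parts of `a` is at most that of `b`. -/
def DomLE (a b : Multiset ℕ) : Prop := ∀ j, psum a j ≤ psum b j

/-- All parts are positive. -/
def PosParts (s : Multiset ℕ) : Prop := ∀ x ∈ s, 0 < x

/-- A partition of an odd number in which every even part has even multiplicity
(a B-partition of `n` when the sum is `2*n+1`). -/
def IsTypeB (s : Multiset ℕ) : Prop :=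
  PosParts s ∧ Odd s.sum ∧ ∀ x, Even x → Even (s.count x)

/-- A partition of an even number in which every odd part has even multiplicity
(a C-partition of `n` when the sum is `2*n`). -/
def IsTypeC (s : Multiset ℕ) : Prop :=
  PosParts s ∧ Even s.sum ∧ ∀ x, Odd x → Even (s.count x)

/-- A partition of an even number in which every even part has even multiplicity
(a D-partition of `n` when the sum is `2*n`). -/
def IsTypeD (s : Multiset ℕ) : Prop :=
  PosParts s ∧ Even s.sum ∧ ∀ x, Even x → Even (s.count x)

/-- `IsCollapse T α β` : `β` is the dominance-largest partition of class `T` of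
the same number as `α` which is dominated by `α` (e.g. the B/C/D-collapse of `α`
for `T = IsTypeB/IsTypeC/IsTypeD`). -/
def IsCollapse (T : Multiset ℕ → Prop) (α β : Multiset ℕ) : Prop :=
  T β ∧ β.sum = α.sum ∧ DomLE β α ∧
    ∀ γ, T γ → γ.sum = α.sum → DomLE γ α → DomLE γ β

/-- The transpose (conjugate) partition: its `j`-th part (0-indexed `j`) is the
number of parts of `s` that are `≥ j+1`. -/
def transpose (s : Multiset ℕ) : Multiset ℕ :=
  (Multiset.range (part s 1)).map (fun j => (s.filter (fun x => j + 1 ≤ x)).card)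

/-- `λ⁻` : subtract 1 from the smallest part (the part being deleted if it
becomes 0). -/
def decMin (s : Multiset ℕ) : Multiset ℕ :=
  ((minPart s - 1) ::ₘ s.erase (minPart s)).filter (fun x => 0 < x)

/-- `λ⁺` : add 1 to the largest part. -/
def incMax (s : Multiset ℕ) : Multiset ℕ :=
  (part s 1 + 1) ::ₘ s.erase (part s 1)

/-- The subpartition `μ` of `T` whose multiplicity at an even `x` is 2 if
`m_T(x)` is even and nonzero, 1 if `m_T(x)` is odd, and 0 at odd `x`. -/
def muEven (T : Multiset ℕ) : Multiset ℕ :=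
  (T.toFinset.filter (fun x => Even x)).val.bind
    (fun x => Multiset.replicate (if Even (T.count x) then 2 else 1) x)

/-- The subpartition `μ` of `T` whose multiplicity at an odd `x` is 2 if
`m_T(x)` is even and nonzero, 1 if `m_T(x)` is odd, and 0 at even `x`. -/
def muOdd (T : Multiset ℕ) : Multiset ℕ :=
  (T.toFinset.filter (fun x => Odd x)).val.bind
    (fun x => Multiset.replicate (if Even (T.count x) then 2 else 1) x)

/-- The subpartition `π` of `T` consisting of the even parts of `T` of odd
multiplicity, each taken once. -/
def piEven (T : Multiset ℕ) : Multiset ℕ :=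
  (T.toFinset.filter (fun x => Even x ∧ Odd (T.count x))).val

/-- `k` is a (1-indexed) position of an odd part of `s`. -/
def OddIdx (s : Multiset ℕ) (k : ℕ) : Prop := 1 ≤ k ∧ Odd (part s k)

/-- `k` is a (1-indexed) position of an even part of `s`. -/
def EvenIdx (s : Multiset ℕ) (k : ℕ) : Prop :=
  1 ≤ k ∧ k ≤ Multiset.card s ∧ Even (part s k)

/-- `e_s(i,j)` : number of positions `i ≤ k ≤ j` with `s_k` even. -/
def eCount (s : Multiset ℕ) (i j : ℕ) : ℕ :=
  ((Finset.Icc i j).filter (fun k => Even (part s k))).card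

/-- number of positions `i ≤ k ≤ j` with `s_k` odd. -/
def oCount (s : Multiset ℕ) (i j : ℕ) : ℕ :=
  ((Finset.Icc i j).filter (fun k => Odd (part s k))).card

/-- `s` is special in the e-count sense: `e_s(1,t₁)` is even, and
`e_s(tᵢ,tᵢ₊₁)` is even for all `1 ≤ i ≤ p-1`, where `t₁ < ⋯ < t_p` are the
positions of the odd parts of `s`. -/
def IsSpecialE (s : Multiset ℕ) : Prop :=
  (∀ t, OddIdx s t → (∀ t', OddIdx s t' → t ≤ t') → Even (eCount s 1 t)) ∧
  (∀ i j, OddIdx s i → OddIdx s j → i < j →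
    (∀ k, OddIdx s k → k ≤ i ∨ j ≤ k) → Even (eCount s i j))

/-- `s` is quasi-special: `e_s(1,t₁)` is even, `e_s(tᵢ,tᵢ₊₁)` is even for all
`1 ≤ i ≤ p-2`, and the smallest part of `s` is odd with multiplicity 1. -/
def IsQuasiSpecialE (s : Multiset ℕ) : Prop :=
  (∀ t, OddIdx s t → (∀ t', OddIdx s t' → t ≤ t') → Even (eCount s 1 t)) ∧
  (∀ i j, OddIdx s i → OddIdx s j → i < j →
    (∀ k, OddIdx s k → k ≤ i ∨ j ≤ k) → (∃ k, OddIdx s k ∧ j < k) →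
      Even (eCount s i j)) ∧
  Odd (minPart s) ∧ s.count (minPart s) = 1

/-- Number of odd parts greater than every even part (equals the number of odd
parts greater than the largest even part, and the number of all odd parts if
there are no even parts). -/
def numOddDominant (s : Multiset ℕ) : ℕ :=
  (s.filter (fun x => Odd x ∧ ∀ y ∈ s, Even y → y < x)).card

/-- Between every pair of consecutive even parts of `s` (in the decreasing
listing of the parts) there is an even number of odd parts. -/
def EvenBetween (s : Multiset ℕ) : Prop :=
  ∀ i j, EvenIdx s i → EvenIdx s j → i < j →
    (∀ k, EvenIdx s k → k ≤ i ∨ j ≤ k) → Even (oCount s i j)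

/-- A special B-partition. -/
def IsSpecialTypeB (s : Multiset ℕ) : Prop :=
  IsTypeB s ∧ EvenBetween s ∧ Odd (numOddDominant s)

/-- A special D-partition. -/
def IsSpecialTypeD (s : Multiset ℕ) : Prop :=
  IsTypeD s ∧ EvenBetween s ∧ Even (numOddDominant s)

theorem sortedDesc_pairwise (s : Multiset ℕ) : (sortedDesc s).Pairwise (· ≥ ·) := by
  simp [sortedDesc, List.pairwise_reverse]

theorem coe_sortedDesc (s : Multiset ℕ) : (sortedDesc s : Multiset ℕ) = s := by
  simp [sortedDesc]

theorem length_sortedDesc (s : Multiset ℕ) : (sortedDesc s).length = s.card := by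
  simp [sortedDesc]

theorem sortedDesc_coe {l : List ℕ} (hl : l.Pairwise (· ≥ ·)) :
    sortedDesc (l : Multiset ℕ) = l :=
  (Multiset.coe_eq_coe.1 (coe_sortedDesc (l : Multiset ℕ))).eq_of_pairwise'
    (sortedDesc_pairwise _) hl

theorem sum_take_succ_getD (l : List ℕ) (k : ℕ) :
    (l.take (k + 1)).sum = (l.take k).sum + l.getD k 0 := by
  rcases lt_or_ge k l.length with h | h
  · rw [List.take_succ_eq_append_getElem h, List.sum_append, List.getD_eq_getElem _ _ h]
    simp
  · rw [List.take_of_length_le h, List.take_of_length_le (h.trans k.le_succ),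
      List.getD_eq_default _ _ h, add_zero]

@[simp] theorem psum_zero (s : Multiset ℕ) : psum s 0 = 0 := by simp [psum]

theorem psum_succ (s : Multiset ℕ) (k : ℕ) :
    psum s (k + 1) = psum s k + part s (k + 1) :=
  sum_take_succ_getD _ _

theorem psum_of_card_le {s : Multiset ℕ} {k : ℕ} (h : s.card ≤ k) : psum s k = s.sum := by
  rw [psum, List.take_of_length_le (by rwa [length_sortedDesc]), ← Multiset.sum_coe,
    coe_sortedDesc]

theorem part_of_card_lt {s : Multiset ℕ} {k : ℕ} (h : s.card < k) : part s k = 0 :=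
  List.getD_eq_default _ _ (by rw [length_sortedDesc]; omega)

theorem part_mem {s : Multiset ℕ} {k : ℕ} (hk : k < s.card) : part s (k + 1) ∈ s := by
  have h : k < (sortedDesc s).length := by rwa [length_sortedDesc]
  have := List.getElem_mem h
  rw [← Multiset.mem_coe, coe_sortedDesc] at this
  rwa [part, Nat.add_sub_cancel, List.getD_eq_getElem _ _ h]

theorem part_antitone (s : Multiset ℕ) : Antitone (part s) := by
  intro i j hij
  unfold part
  rcases lt_or_ge (j - 1) (sortedDesc s).length with h | h
  · have hi : i - 1 < (sortedDesc s).length := by omega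
    rw [List.getD_eq_getElem _ _ h, List.getD_eq_getElem _ _ hi]
    rcases (show i - 1 ≤ j - 1 by omega).eq_or_lt with he | hl
    · simp [he]
    · exact List.pairwise_iff_getElem.1 (sortedDesc_pairwise s) _ _ hi h hl
  · rw [List.getD_eq_default _ _ h]
    exact Nat.zero_le _

/-- The sum of the parts that are at least `y` is a partial sum. -/
theorem sum_filter_le_eq_psum {s : Multiset ℕ} {k y : ℕ} (hlow : part s (k + 1) < y)
    (hup : ∀ i < k, y ≤ part s (i + 1)) : (s.filter (y ≤ ·)).sum = psum s k := by
  have hsplit := List.take_append_drop k (sortedDesc s)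
  have htake : ((sortedDesc s).take k).filter (fun x => decide (y ≤ x)) =
      (sortedDesc s).take k := by
    rw [List.filter_eq_self]
    intro x hx
    obtain ⟨i, hi, rfl⟩ := List.mem_iff_getElem.1 hx
    simp only [List.length_take, lt_min_iff] at hi
    have := hup i hi.1
    rw [part, Nat.add_sub_cancel, List.getD_eq_getElem _ _ hi.2] at this
    simpa using this
  have hdrop : ((sortedDesc s).drop k).filter (fun x => decide (y ≤ x)) = [] := by
    rw [List.filter_eq_nil_iff]
    intro x hx
    obtain ⟨i, hi, rfl⟩ := List.mem_iff_getElem.1 hx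
    simp only [List.length_drop] at hi
    have hki : k + i < (sortedDesc s).length := by omega
    have := part_antitone s (show k + 1 ≤ k + i + 1 by omega)
    simp only [List.getElem_drop, decide_eq_true_eq, not_le]
    simp only [part, Nat.add_sub_cancel, List.getD_eq_getElem _ _ hki] at this hlow
    exact this.trans_lt hlow
  conv_lhs => rw [← coe_sortedDesc s]
  rw [Multiset.filter_coe, Multiset.sum_coe, psum]
  conv_lhs => rw [← hsplit]
  rw [List.filter_append, htake, hdrop, List.append_nil]

theorem even_sum_filter_le {s : Multiset ℕ} (h : ∀ x, Odd x → Even (s.count x)) (y : ℕ) :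
    Even (s.filter (y ≤ ·)).sum := by
  rw [Finset.sum_multiset_count]
  refine Finset.even_sum _ fun x _ => ?_
  rw [smul_eq_mul]
  rcases Nat.even_or_odd x with hx | hx
  · exact hx.mul_left _
  · refine Even.mul_right ?_ _
    rw [Multiset.count_filter]
    split_ifs
    exacts [h x hx, Even.zero]

theorem even_count_of_even_sum_filter_le {s : Multiset ℕ}
    (h : ∀ y, 0 < y → Even (s.filter (y ≤ ·)).sum) {x : ℕ} (hx : Odd x) :
    Even (s.count x) := by
  have hsplit : s.filter (x ≤ ·) = s.filter (x + 1 ≤ ·) + s.filter (x = ·) := by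
    ext z
    simp only [Multiset.count_add, Multiset.count_filter]
    split_ifs <;> omega
  have hsum := congrArg Multiset.sum hsplit
  rw [Multiset.sum_add, Multiset.filter_eq, Multiset.sum_replicate, smul_eq_mul] at hsum
  have h₁ := h x hx.pos
  rw [hsum, Nat.even_add, iff_true_left (h _ x.succ_pos), Nat.even_mul] at h₁
  exact h₁.resolve_right (Nat.not_even_iff_odd.2 hx)

/-- The partial sums of a C-partition are even at every descent. -/
theorem IsTypeC.even_psum {s : Multiset ℕ} (hs : IsTypeC s) {k : ℕ}
    (hk : part s (k + 1) < part s k) : Even (psum s k) := by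
  rw [← sum_filter_le_eq_psum hk fun i hi => part_antitone s hi]
  exact even_sum_filter_le hs.2.2 _

/-- A partition whose partial sums are even at every descent is a C-partition. -/
theorem isTypeC_of_even_psum {s : Multiset ℕ} (hpos : PosParts s) (hsum : Even s.sum)
    (h : ∀ k, part s (k + 1) < part s k → Even (psum s k)) : IsTypeC s := by
  refine ⟨hpos, hsum, fun x hx => even_count_of_even_sum_filter_le (fun y hy => ?_) hx⟩
  have hex : ∃ k, part s (k + 1) < y :=
    ⟨s.card, by rwa [part_of_card_lt (Nat.lt_succ_self _)]⟩
  have hup : ∀ i < Nat.find hex, y ≤ part s (i + 1) := fun i hi =>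
    not_lt.1 (Nat.find_min hex hi)
  rw [sum_filter_le_eq_psum (Nat.find_spec hex) hup]
  rcases hk : Nat.find hex with _ | k
  · simp
  · refine h _ ?_
    rw [← hk]
    refine (Nat.find_spec hex).trans_le ?_
    rw [hk]
    exact hup k (by omega)

/-- The amount by which the C-collapse lowers the `k`-th partial sum. -/
def deficit (s : Multiset ℕ) (k : ℕ) : ℕ :=
  if Odd (psum s k) ∧ ¬(part s k = part s (k + 1) ∧ Odd (part s k)) then 1 else 0

/-- The `k`-th part of the C-collapse. -/
def collapsePart (s : Multiset ℕ) (k : ℕ) : ℕ :=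
  part s k + deficit s (k - 1) - deficit s k

/-- An explicit description of the C-collapse. -/
def collapseC (s : Multiset ℕ) : Multiset ℕ :=
  ((List.range s.card).map fun k => collapsePart s (k + 1) : List ℕ)

@[simp] theorem deficit_zero (s : Multiset ℕ) : deficit s 0 = 0 := by simp [deficit]

theorem deficit_of_even {s : Multiset ℕ} {k : ℕ} (h : Even (psum s k)) :
    deficit s k = 0 := by
  rw [deficit, if_neg]
  exact fun h' => Nat.not_even_iff_odd.2 h'.1 h

theorem collapsePart_add (s : Multiset ℕ) (k : ℕ) :
    collapsePart s (k + 1) + deficit s (k + 1) = part s (k + 1) + deficit s k := by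
  have h₁ := psum_succ s k
  have : deficit s (k + 1) ≤ part s (k + 1) + deficit s k := by
    simp only [deficit, Nat.odd_iff]
    split_ifs <;> omega
  simp only [collapsePart, Nat.add_sub_cancel]
  omega

theorem collapsePart_succ_le (s : Multiset ℕ) (k : ℕ) :
    collapsePart s (k + 2) ≤ collapsePart s (k + 1) := by
  have h₁ := collapsePart_add s k
  have h₂ := collapsePart_add s (k + 1)
  have h₃ := psum_succ s k
  have h₄ := psum_succ s (k + 1)
  have h₅ := part_antitone s (k + 1).le_succ
  simp only [deficit, Nat.odd_iff] at h₁ h₂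
  simp only [Nat.succ_eq_add_one, add_assoc, Nat.reduceAdd] at *
  split_ifs at h₁ h₂ <;> omega

theorem collapsePart_antitone (s : Multiset ℕ) :
    Antitone fun k => collapsePart s (k + 1) :=
  antitone_nat_of_succ_le (collapsePart_succ_le s)

theorem even_collapse_psum (s : Multiset ℕ) (k : ℕ)
    (h : collapsePart s (k + 2) < collapsePart s (k + 1)) :
    Even (psum s (k + 1) - deficit s (k + 1)) := by
  have h₁ := collapsePart_add s k
  have h₂ := collapsePart_add s (k + 1)
  have h₃ := psum_succ s k
  have h₄ := psum_succ s (k + 1)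
  simp only [deficit, Nat.odd_iff, Nat.even_iff] at h₁ h₂ ⊢
  simp only [add_assoc, Nat.reduceAdd] at *
  split_ifs at h₁ h₂ ⊢ <;> omega

theorem sortedDesc_collapseC (s : Multiset ℕ) :
    sortedDesc (collapseC s) = (List.range s.card).map fun k => collapsePart s (k + 1) := by
  refine sortedDesc_coe ?_
  rw [List.pairwise_map]
  exact List.pairwise_lt_range.imp fun h => collapsePart_antitone s h.le

theorem card_collapseC (s : Multiset ℕ) : (collapseC s).card = s.card := by
  simp [collapseC]

theorem deficit_of_card_le {s : Multiset ℕ} (hs : Even s.sum) {k : ℕ} (hk : s.card ≤ k) :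
    deficit s k = 0 :=
  deficit_of_even (by rwa [psum_of_card_le hk])

theorem part_collapseC {s : Multiset ℕ} (hs : Even s.sum) (k : ℕ) :
    part (collapseC s) (k + 1) = collapsePart s (k + 1) := by
  rcases lt_or_ge k s.card with h | h
  · rw [part, sortedDesc_collapseC, List.getD_eq_getElem _ _ (by simpa using h)]
    simp
  · rw [part_of_card_lt (by rw [card_collapseC]; omega)]
    have := collapsePart_add s k
    rw [deficit_of_card_le hs h, deficit_of_card_le hs (h.trans k.le_succ),
      part_of_card_lt (Nat.lt_succ_of_le h)] at this
    omega

theorem psum_collapseC {s : Multiset ℕ} (hs : Even s.sum) (k : ℕ) :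
    psum (collapseC s) k + deficit s k = psum s k := by
  induction k with
  | zero => simp
  | succ k ih =>
    rw [psum_succ, psum_succ, part_collapseC hs, ← ih]
    have := collapsePart_add s k
    omega

theorem sum_collapseC {s : Multiset ℕ} (hs : Even s.sum) : (collapseC s).sum = s.sum := by
  have := psum_collapseC hs s.card
  rwa [deficit_of_card_le hs le_rfl, add_zero, psum_of_card_le le_rfl,
    psum_of_card_le (card_collapseC s).le] at this

theorem posParts_collapseC {s : Multiset ℕ} (hpos : PosParts s) (hs : Even s.sum) :
    PosParts (collapseC s) := by
  intro x hx
  simp only [collapseC, Multiset.mem_coe, List.mem_map, List.mem_range] at hx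
  obtain ⟨k, hk, rfl⟩ := hx
  obtain ⟨n, hn⟩ : ∃ n, s.card = n + 1 := ⟨s.card - 1, by omega⟩
  have hle : collapsePart s (n + 1) ≤ collapsePart s (k + 1) :=
    collapsePart_antitone s (show k ≤ n by omega)
  have hadd := collapsePart_add s n
  rw [deficit_of_card_le hs hn.le] at hadd
  have := hpos _ (part_mem (show n < s.card by omega))
  omega

theorem isTypeC_collapseC {s : Multiset ℕ} (hpos : PosParts s) (hs : Even s.sum) :
    IsTypeC (collapseC s) := by
  refine isTypeC_of_even_psum (posParts_collapseC hpos hs) (by rwa [sum_collapseC hs]) ?_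
  rintro (_ | k) hk
  · simp
  · rw [part_collapseC hs, part_collapseC hs] at hk
    rw [Nat.eq_sub_of_add_eq (psum_collapseC hs (k + 1))]
    exact even_collapse_psum s k hk

/-- If a C-partition `t ≤ s` attains an odd partial sum of `s`, then this happens inside a
run of equal odd parts of `s`. -/
theorem part_eq_of_psum_eq {s t : Multiset ℕ} (ht : IsTypeC t) (hts : DomLE t s) (k : ℕ)
    (hodd : Odd (psum s k)) (heq : psum t k = psum s k) :
    part s k = part s (k + 1) ∧ Odd (part s k) := by
  induction k with
  | zero => simp at hodd
  | succ k ih =>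
    have hflat : part t (k + 1) ≤ part t (k + 2) := by
      by_contra hlt
      exact Nat.not_even_iff_odd.2 (heq ▸ hodd) (ht.even_psum (not_le.1 hlt))
    have h₁ := hts k
    have h₂ := hts (k + 2)
    have h₃ := psum_succ s k
    have h₄ := psum_succ s (k + 1)
    have h₅ := psum_succ t k
    have h₆ := psum_succ t (k + 1)
    have h₇ := part_antitone s (k + 1).le_succ
    simp only [Nat.succ_eq_add_one, Nat.odd_iff, add_assoc, Nat.reduceAdd] at *
    refine ⟨by omega, ?_⟩
    by_contra heven
    have := ih (by omega) (by omega)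
    omega

theorem domLE_collapseC {s t : Multiset ℕ} (hs : Even s.sum) (ht : IsTypeC t)
    (hts : DomLE t s) : DomLE t (collapseC s) := by
  intro k
  have h₁ := psum_collapseC hs k
  have h₂ := hts k
  unfold deficit at h₁
  split_ifs at h₁ with h
  · by_contra hlt
    exact h.2 (part_eq_of_psum_eq ht hts k h.1 (by omega))
  · omega

theorem IsCollapse.psum_add_deficit {s t : Multiset ℕ} (hpos : PosParts s)
    (hs : Even s.sum) (h : IsCollapse IsTypeC s t) (k : ℕ) :
    psum t k + deficit s k = psum s k := by
  obtain ⟨htype, -, hle, hmax⟩ := h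
  have hdom : DomLE (collapseC s) s := fun j => by
    have := psum_collapseC hs j
    omega
  have h₁ := hmax _ (isTypeC_collapseC hpos hs) (sum_collapseC hs) hdom k
  have h₂ := domLE_collapseC hs htype hle k
  have h₃ := psum_collapseC hs k
  omega

theorem eCount_add {s : Multiset ℕ} {i j : ℕ} (hi : OddIdx s i) (hij : i ≤ j) :
    eCount s 1 i + eCount s i j = eCount s 1 j := by
  have hodd : ∀ k, k = i → ¬ Even (part s k) := fun k hk =>
    hk ▸ Nat.not_even_iff_odd.2 hi.2
  have h1 := hi.1
  unfold eCount
  rw [← Finset.card_union_of_disjoint]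
  · congr 1
    ext k
    have := hodd k
    simp only [Finset.mem_union, Finset.mem_filter, Finset.mem_Icc]
    constructor
    · rintro (⟨h, he⟩ | ⟨h, he⟩) <;> exact ⟨by omega, he⟩
    · rintro ⟨h, he⟩
      rcases le_total k i with hki | hki
      · exact Or.inl ⟨by omega, he⟩
      · exact Or.inr ⟨by omega, he⟩
  · rw [Finset.disjoint_left]
    simp only [Finset.mem_filter, Finset.mem_Icc]
    rintro k ⟨hk, he⟩ ⟨hk', -⟩
    exact hodd k (by omega) he

theorem isSpecialE_iff (s : Multiset ℕ) :
    IsSpecialE s ↔ ∀ k, OddIdx s k → Even (eCount s 1 k) := by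
  classical
  constructor
  · rintro ⟨hfirst, hnext⟩ k
    induction k using Nat.strong_induction_on with
    | _ k ih =>
      intro hk
      by_cases hex : ∃ i, i < k ∧ OddIdx s i
      · obtain ⟨i₀, hi₀, hodd₀⟩ := hex
        have hspec := Nat.findGreatest_spec (P := fun i => i < k ∧ OddIdx s i) hi₀.le
          ⟨hi₀, hodd₀⟩
        set i := Nat.findGreatest (fun i => i < k ∧ OddIdx s i) k
        rw [← eCount_add hspec.2 hspec.1.le]
        refine (ih i hspec.1 hspec.2).add (hnext i k hspec.2 hk hspec.1 fun j hj => ?_)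
        by_contra! hcon
        exact hcon.1.not_ge (Nat.le_findGreatest hcon.2.le ⟨hcon.2, hj⟩)
      · push Not at hex
        exact hfirst k hk fun j hj => not_lt.1 fun hlt => hex j hlt hj
  · intro h
    refine ⟨fun t ht _ => h t ht, fun i j hi hj hij _ => ?_⟩
    have := h j hj
    rw [← eCount_add hi hij.le, Nat.even_add] at this
    exact this.1 (h i hi)

theorem even_eCount_add_psum (s : Multiset ℕ) (k : ℕ) :
    Even (eCount s 1 k + psum s k + k) := by
  induction k with
  | zero => simp [eCount]
  | succ k ih =>
    have hcount : eCount s 1 (k + 1) =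
        eCount s 1 k + if Even (part s (k + 1)) then 1 else 0 := by
      unfold eCount
      rw [← Finset.insert_Icc_right_eq_Icc_add_one (by omega), Finset.filter_insert]
      split_ifs <;> simp
    rw [psum_succ, hcount]
    simp only [Nat.even_iff] at *
    split_ifs <;> omega

/-- If a partition `α` of an even number is special (in the
e-count sense), then its C-collapse `α_C` is special. -/
theorem statement1 (a : Multiset ℕ) (hpos : PosParts a) (heven : Even a.sum)
    (hspec : IsSpecialE a)
    (b : Multiset ℕ) (hb : IsCollapse IsTypeC a b) :
    IsSpecialE b := by
  rw [isSpecialE_iff] at hspec ⊢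
  rintro (_ | k) ⟨h1, hodd⟩
  · omega
  have h₁ := hb.psum_add_deficit hpos heven k
  have h₂ := hb.psum_add_deficit hpos heven (k + 1)
  have h₃ := psum_succ a k
  have h₄ := psum_succ b k
  have hkey : Odd (part a (k + 1)) ∧ psum b (k + 1) = psum a (k + 1) := by
    simp only [deficit, Nat.odd_iff] at *
    split_ifs at h₁ h₂ <;> omega
  have h₅ := hspec (k + 1) ⟨h1, hkey.1⟩
  have h₆ := even_eCount_add_psum a (k + 1)
  have h₇ := even_eCount_add_psum b (k + 1)
  rw [hkey.2] at h₇
  simp only [Nat.even_iff] at *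
  omega

end WFPaper
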